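/- The quintupling feasible domain f_d is a nonempty open subset of ℝ, and every c ∈ f_d satisfies 0.379 < c < 0.391. -/

import Mathlib

/-- The unimodal map `u_c(x) = 1 - ((x - c)/(1 - c))^2`. -/
noncomputable def u (c x : ℝ) : ℝ := 1 - ((x - c) / (1 - c)) ^ 2

/-- `uIter c k = u_c^k(0)`, the `k`-th iterate of `u_c` at `0`. -/
noncomputable def uIter (c : ℝ) (k : ℕ) : ℝ := (u c)^[k] 0

/-- Period-quintupling scaling function `Q₁(c) = u_c⁵(0)`. -/
noncomputable def Q1 (c : ℝ) : ℝ := uIter c 5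
/-- Period-quintupling scaling function `Q₂(c) = u_c⁸(0) − u_c³(0)`. -/
noncomputable def Q2 (c : ℝ) : ℝ := uIter c 8 - uIter c 3
/-- Period-quintupling scaling function `Q₃(c) = u_c⁶(0) − u_c(0)`. -/
noncomputable def Q3 (c : ℝ) : ℝ := uIter c 6 - uIter c 1
/-- Period-quintupling scaling function `Q₄(c) = u_c²(0) − u_c⁷(0)`. -/
noncomputable def Q4 (c : ℝ) : ℝ := uIter c 2 - uIter c 7
/-- Period-quintupling scaling function `Q₅(c) = 1 − u_c⁴(0)`. -/
noncomputable def Q5 (c : ℝ) : ℝ := 1 - uIter c 4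
/-- Gap function `H_l(c) = u_c³(0) − u_c⁵(0)`. -/
noncomputable def Hl (c : ℝ) : ℝ := uIter c 3 - uIter c 5
/-- Gap function `H₁(c) = u_c(0) − u_c⁸(0)`. -/
noncomputable def H1 (c : ℝ) : ℝ := uIter c 1 - uIter c 8
/-- Gap function `H₂(c) = u_c⁷(0) − u_c⁶(0)`. -/
noncomputable def H2 (c : ℝ) : ℝ := uIter c 7 - uIter c 6
/-- Gap function `H₃(c) = u_c⁴(0) − u_c²(0)`. -/
noncomputable def H3 (c : ℝ) : ℝ := uIter c 4 - uIter c 2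
/-- The period-quintupling renormalization map `R₅(c) = (u_c⁸(0) − c)/Q₂(c)`. -/
noncomputable def R5 (c : ℝ) : ℝ := (uIter c 8 - c) / Q2 c
/-- The quintupling feasible domain `f_d`. -/
def fd : Set ℝ :=
  {c | c ∈ Set.Ioo (0 : ℝ) (1 / 2) ∧ 0 < Q1 c ∧ 0 < Q2 c ∧ 0 < Q3 c ∧ 0 < Q4 c ∧ 0 < Q5 c ∧
    0 < Hl c ∧ 0 < H1 c ∧ 0 < H2 c ∧ 0 < H3 c}


lemma uIter_succ' (c : ℝ) (k : ℕ) : uIter c (k + 1) = 1 - ((uIter c k - c) / (1 - c)) ^ 2 := by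
  unfold uIter
  rw [Function.iterate_succ_apply']
  rfl

lemma uIter_zero' (c : ℝ) : uIter c 0 = 0 := rfl

lemma uIter_cont (c : ℝ) (hc : c ≠ 1) (k : ℕ) : ContinuousAt (fun c => uIter c k) c := by
  induction k with
  | zero => exact continuousAt_const
  | succ k ih =>
    simp only [uIter_succ']
    have : 1 - c ≠ 0 := fun h => hc (by linarith)
    exact continuousAt_const.sub (((ih.sub continuousAt_id).div
      (continuousAt_const.sub continuousAt_id) this).pow 2)

lemma fd_open : IsOpen fd := by
  rw [isOpen_iff_mem_nhds]
  rintro c ⟨h0, h1, h2, h3, h4, h5, h6, h7, h8, h9⟩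
  have hc : c ≠ 1 := by
    have := h0.2
    intro h
    rw [h] at this
    norm_num at this
  have K := uIter_cont c hc
  have e0 := isOpen_Ioo.mem_nhds h0
  have e1 := (K 5).eventually_const_lt h1
  have e2 := ((K 8).sub (K 3)).eventually_const_lt h2
  have e3 := ((K 6).sub (K 1)).eventually_const_lt h3
  have e4 := ((K 2).sub (K 7)).eventually_const_lt h4
  have e5 := ((continuousAt_const (y := (1 : ℝ))).sub (K 4)).eventually_const_lt h5
  have e6 := ((K 3).sub (K 5)).eventually_const_lt h6
  have e7 := ((K 1).sub (K 8)).eventually_const_lt h7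
  have e8 := ((K 7).sub (K 6)).eventually_const_lt h8
  have e9 := ((K 4).sub (K 2)).eventually_const_lt h9
  filter_upwards [e0, e1, e2, e3, e4, e5, e6, e7, e8, e9] with x a0 a1 a2 a3 a4 a5 a6 a7 a8 a9
  exact ⟨a0, a1, a2, a3, a4, a5, a6, a7, a8, a9⟩

lemma fd_mem : (5 / 13 : ℝ) ∈ fd := by
  refine ⟨⟨by norm_num, by norm_num⟩, ?_⟩
  simp only [Q1, Q2, Q3, Q4, Q5, Hl, H1, H2, H3]
  have a0 := uIter_zero' (5 / 13)
  have a1 := uIter_succ' (5 / 13) 0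
  have a2 := uIter_succ' (5 / 13) 1
  have a3 := uIter_succ' (5 / 13) 2
  have a4 := uIter_succ' (5 / 13) 3
  have a5 := uIter_succ' (5 / 13) 4
  have a6 := uIter_succ' (5 / 13) 5
  have a7 := uIter_succ' (5 / 13) 6
  have a8 := uIter_succ' (5 / 13) 7
  rw [a0] at a1
  norm_num at a1
  norm_num [a1] at a2
  norm_num [a2] at a3
  norm_num [a3] at a4
  norm_num [a4] at a5
  norm_num [a5] at a6
  norm_num [a6] at a7
  norm_num [a7] at a8
  rw [a1, a2, a3, a4, a5, a6, a7, a8]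
  norm_num

/-- Numeric bounds `L ≤ s ≤ S` propagate along the orbit and bound `|p5|`. -/
lemma chain_bound (s p5 p6 p7 p8 L S b8 b7 b6 b5 : ℝ) (hs : 1 < s) (hL : L ≤ s) (hS : s ≤ S)
    (h6 : p6 = 1 - s * p5 ^ 2) (h7 : p7 = 1 - s * p6 ^ 2) (h8 : p8 = 1 - s * p7 ^ 2)
    (n7 : p7 < 0) (n6 : 0 < p6) (g8 : s * p8 ^ 2 < 2 - s)
    (_L0 : 0 < L) (b8p : 0 < b8) (b7p : 0 < b7) (b5p : 0 < b5) (k8 : 2 - L ≤ L * b8 ^ 2)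
    (k7 : S * b7 ^ 2 ≤ 1 - b8) (k6 : S * b6 ^ 2 ≤ 1 + b7)
    (k5 : 1 - b6 ≤ L * b5 ^ 2) : -b5 < p5 ∧ p5 < b5 := by
  have H8 : p8 < b8 := by
    by_contra h
    push Not at h
    have := mul_le_mul hL (pow_le_pow_left₀ b8p.le h 2) (by positivity) (by linarith)
    linarith
  have e7 : b7 ^ 2 < p7 ^ 2 := by
    by_contra h
    push Not at h
    have := mul_le_mul hS h (sq_nonneg p7) (by linarith)
    linarith
  have f7 : p7 < -b7 := by
    by_contra h
    push Not at h
    nlinarith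
  have e6 : b6 ^ 2 < p6 ^ 2 := by
    by_contra h
    push Not at h
    have := mul_le_mul hS h (sq_nonneg p6) (by linarith)
    linarith
  have f6 : b6 < p6 := lt_of_pow_lt_pow_left₀ 2 n6.le e6
  have e5 : p5 ^ 2 < b5 ^ 2 := by
    by_contra h
    push Not at h
    have := mul_le_mul hL h (sq_nonneg b5) (by linarith)
    linarith
  exact abs_lt.1 (abs_lt_of_sq_lt_sq e5 b5p.le)

lemma of_mul (s a b : ℝ) (s0 : 0 < s) (h : s * a < s * b) : a < b :=
  lt_of_mul_lt_mul_left h s0.le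

set_option maxHeartbeats 1600000 in
lemma core (s p3 p4 p5 p6 p7 p8 p9 p10 : ℝ) (hs : 1 < s) (hs2 : s < 2)
    (h3 : p3 = 1 - s * (1 - s) ^ 2) (h4 : p4 = 1 - s * p3 ^ 2) (h5 : p5 = 1 - s * p4 ^ 2)
    (h6 : p6 = 1 - s * p5 ^ 2) (h7 : p7 = 1 - s * p6 ^ 2) (h8 : p8 = 1 - s * p7 ^ 2)
    (h9 : p9 = 1 - s * p8 ^ 2) (h10 : p10 = 1 - s * p9 ^ 2)
    (o2 : p5 < p3) (o3 : p10 < p3) (o4 : p3 < p8) (o5 : p8 < p9)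
    (o6 : p9 < p4) (o7 : p4 < p6) (o1 : p7 < p5) : 1.6104 < s ∧ s < 1.642 := by
  have s0 : 0 < s := by linarith
  have n3 : 0 < p3 := by
    have q : p5 ^ 2 < p3 ^ 2 := of_mul s _ _ s0 (by linarith)
    have := abs_lt.1 (sq_lt_sq.1 q)
    by_contra h
    push Not at h
    rw [abs_of_nonpos h] at this
    linarith [this.1]
  have n7 : p7 < 0 := by
    by_contra h
    push Not at h
    have q : p8 ^ 2 < p7 ^ 2 := of_mul s _ _ s0 (by linarith)
    linarith [lt_of_pow_lt_pow_left₀ 2 h q]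
  have n6 : 0 < p6 := by linarith
  have n8 : 0 < p8 := by linarith
  have n9 : 0 < p9 := by linarith
  have g9 : s - 1 < p9 := by
    have q : (1 - s) ^ 2 < p9 ^ 2 := of_mul s _ _ s0 (by linarith)
    exact lt_of_pow_lt_pow_left₀ 2 n9.le (by linarith)
  have g8 : s * p8 ^ 2 < 2 - s := by linarith
  have g3 : p3 < s - 1 := by
    have q : p3 ^ 2 < (1 - s) ^ 2 := of_mul s _ _ s0 (by linarith)
    exact lt_of_pow_lt_pow_left₀ 2 (by linarith) (by linarith)
  have hl : 1.54 < s := by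
    by_contra h
    push Not at h
    have a : (s - 1) ^ 2 ≤ 0.54 ^ 2 := pow_le_pow_left₀ (by linarith) (by linarith) 2
    have := mul_le_mul_of_nonneg_left a s0.le
    linarith
  have CB := fun L S b8 b7 b6 b5 hL hS => chain_bound s p5 p6 p7 p8 L S b8 b7 b6 b5 hs hL hS
    h6 h7 h8 n7 n6 g8
  constructor
  · by_contra h
    push Not at h
    obtain ⟨t, ht⟩ : ∃ t, t = 1.6104 - s := ⟨_, rfl⟩
    have t0 : 0 ≤ t := by linarith
    have t1 : t ≤ 0.0704 := by linarith
    have es : s = 1.6104 - t := by linarith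
    have p3g : 0.3999 + 2 * t ≤ p3 := by
      rw [h3, es]
      have := pow_nonneg t0 3
      nlinarith [mul_nonneg t0 (sub_nonneg.2 t1)]
    have p3s : 0.6439 ≤ s * p3 := by
      have := mul_le_mul_of_nonneg_left p3g s0.le
      rw [es] at this ⊢
      nlinarith [mul_nonneg t0 (sub_nonneg.2 t1)]
    have p3ss : 0.2574 ≤ s * p3 ^ 2 := by
      have := mul_le_mul p3s (show 0.3999 ≤ p3 by linarith) (by norm_num) (by positivity)
      linarith
    have p4p : 0 < p4 := by linarith
    have p4s : p4 ^ 2 ≤ 0.7426 ^ 2 := pow_le_pow_left₀ p4p.le (by linarith) 2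
    have p5g : 0.1117 ≤ p5 := by
      have := mul_le_mul h p4s (by positivity) (by norm_num)
      linarith
    rcases le_total s 1.59 with hm | hm
    · have := CB 1.54 1.59 0.547 0.5336 0.982 0.109 hl.le hm (by norm_num) (by norm_num)
        (by norm_num) (by norm_num) (by norm_num) (by norm_num) (by norm_num) (by norm_num)
      linarith [this.2]
    · have := CB 1.59 1.6104 0.508 0.5526 0.9818 0.1075 hm h (by norm_num) (by norm_num)
        (by norm_num) (by norm_num) (by norm_num) (by norm_num) (by norm_num) (by norm_num)
      linarith [this.2]
  · by_contra h
    push Not at h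
    obtain ⟨t, ht⟩ : ∃ t, t = s - 1.642 := ⟨_, rfl⟩
    have t0 : 0 ≤ t := by linarith
    have es : s = 1.642 + t := by linarith
    have p3l : p3 ≤ 0.3233 - 2.5 * t := by
      rw [h3, es]
      have := pow_nonneg t0 3
      nlinarith [mul_nonneg t0 t0]
    have t1 : t ≤ 0.1294 := by linarith
    have p3s : s * p3 ≤ 0.5309 - 3.7 * t := by
      have := mul_le_mul_of_nonneg_left p3l s0.le
      rw [es] at this ⊢
      nlinarith [mul_nonneg t0 t0]
    have key : ∀ a b : ℝ, 0 < b → a * b ≤ 1 → s * p3 ≤ a → p3 ≤ b → 1 - a * b ≤ p4 := by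
      intro a b hb hab h1 h2
      have := mul_le_mul h1 h2 n3.le (by linarith [mul_pos s0 n3])
      rw [h4]
      linarith
    have key5 : ∀ L e : ℝ, 0 < e → 0 < L → L ≤ s → e ≤ p4 → p5 ≤ 1 - L * e ^ 2 := by
      intro L e he hL hLs h1
      have := mul_le_mul hLs (pow_le_pow_left₀ he.le h1 2) (by positivity) s0.le
      linarith
    rcases le_total s 1.66 with hm | hm
    · have p4g := key 0.5309 0.3233 (by norm_num) (by norm_num) (by linarith) (by linarith)
      have p4g' : 0.8283 ≤ p4 := by linarith
      rcases le_total s 1.65 with hn | hn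
      · have p5l := key5 1.642 _ (by norm_num) (by norm_num) h p4g'
        have := CB 1.642 1.65 0.467 0.5683 0.9749 0.1245 h hn (by norm_num) (by norm_num)
          (by norm_num) (by norm_num) (by norm_num) (by norm_num) (by norm_num) (by norm_num)
        linarith [this.1]
      · have p5l := key5 1.65 _ (by norm_num) (by norm_num) hn p4g'
        have := CB 1.65 1.66 0.4607 0.5699 0.9724 0.13 hn hm (by norm_num) (by norm_num)
          (by norm_num) (by norm_num) (by norm_num) (by norm_num) (by norm_num) (by norm_num)
        linarith [this.1]
    · have p4g := key 0.4643 0.2783 (by norm_num) (by norm_num) (by linarith) (by linarith)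
      have p4g' : 0.87 ≤ p4 := by linarith
      have p5l := key5 1.66 _ (by norm_num) (by norm_num) hm p4g'
      have := CB 1.66 1.7714 0.453 0.5550 0.936 0.2 hm (by linarith) (by norm_num) (by norm_num)
        (by norm_num) (by norm_num) (by norm_num) (by norm_num) (by norm_num) (by norm_num)
      linarith [this.1]

theorem stmt_17 :
    IsOpen fd ∧ fd.Nonempty ∧ ∀ c ∈ fd, 0.379 < c ∧ c < 0.391 := by
  refine ⟨fd_open, ⟨_, fd_mem⟩, ?_⟩
  rintro c ⟨⟨c0, c1⟩, h1, h2, h3, h4, h5, h6, h7, h8, h9⟩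
  simp only [Q1, Q2, Q3, Q4, Q5, Hl, H1, H2, H3] at *
  have d : 0 < 1 - c := by linarith
  obtain ⟨s, hs⟩ : ∃ s, s = 1 / (1 - c) := ⟨_, rfl⟩
  have sd : s * (1 - c) = 1 := by rw [hs]; field_simp
  have sp : 0 < s := by rw [hs]; positivity
  have hs1 : 1 < s := by nlinarith
  have hs2 : s < 2 := by nlinarith
  have step : ∀ k, (uIter c (k + 1) - c) * s = 1 - s * ((uIter c k - c) * s) ^ 2 := by
    intro k
    rw [uIter_succ', div_eq_mul_one_div, ← hs]
    linear_combination sd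
  have z : (uIter c 0 - c) * s = 1 - s := by
    rw [uIter_zero']
    linear_combination sd
  have mono : ∀ i j, 0 < uIter c i - uIter c j → (uIter c j - c) * s < (uIter c i - c) * s := by
    intro i j h
    exact mul_lt_mul_of_pos_right (by linarith) sp
  have st0 := step 0
  rw [z] at st0
  obtain ⟨A, B⟩ := core s _ _ _ _ _ _ _ _ hs1 hs2 st0 (step 1) (step 2) (step 3) (step 4)
    (step 5) (step 6) (step 7) (mono 1 3 (by linarith)) (mono 1 8 h7) (mono 6 1 h3) (mono 7 6 h8)
    (mono 2 7 h4) (mono 4 2 h9) (mono 3 5 h6)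
  · constructor
    · by_contra h
      push Not at h
      have := mul_le_mul A.le (show (0.621 : ℝ) ≤ 1 - c by linarith) (by norm_num) sp.le
      norm_num at this
      linarith
    · by_contra h
      push Not at h
      have := mul_le_mul B.le (show 1 - c ≤ (0.609 : ℝ) by linarith) d.le (by norm_num)
      norm_num at this
      linarith
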